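/- Let c > 0 and A > 0, let W, U, V ∈ Ω, and suppose A satisfies the subcharacteristic condition for the pairs (W,U) and (U,V). Let Δt, Δx > 0 satisfy the CFL condition A·Δt/Δx ≤ 1/2, and define the updated state U' = U − (Δt/Δx)(g_A(U,V) − g_A(W,U)). Then U' ∈ Ω (its density is positive) and the discrete entropy inequality holds: E(U') ≤ E(U) − (Δt/Δx)(F̂_A(U,V) − F̂_A(W,U)). -/

import Mathlib

open Real Set

/-- Flux of the isothermal Euler system: `f(ρ,q) = (q, q²/ρ + c²ρ)`. -/
noncomputable def flux (c : ℝ) (U : ℝ × ℝ) : ℝ × ℝ :=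
  (U.2, U.2 ^ 2 / U.1 + c ^ 2 * U.1)

/-- Rusanov numerical flux with speed `A`. -/
noncomputable def rus (c A : ℝ) (UL UR : ℝ × ℝ) : ℝ × ℝ :=
  (1 / 2 : ℝ) • (flux c UL + flux c UR) - (A / 2) • (UR - UL)

/-- Middle state of the Rusanov approximate Riemann solver. -/
noncomputable def mid (c A : ℝ) (UL UR : ℝ × ℝ) : ℝ × ℝ :=
  (1 / 2 : ℝ) • (UL + UR) - (1 / (2 * A)) • (flux c UR - flux c UL)

/-- Entropy `E(ρ,q) = q²/(2ρ) + c²ρ log ρ`. -/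
noncomputable def ent (c : ℝ) (U : ℝ × ℝ) : ℝ :=
  U.2 ^ 2 / (2 * U.1) + c ^ 2 * U.1 * Real.log U.1

/-- Entropy flux `F(ρ,q) = (q/ρ)(E(ρ,q) + c²ρ)`. -/
noncomputable def entFlux (c : ℝ) (U : ℝ × ℝ) : ℝ :=
  U.2 / U.1 * (ent c U + c ^ 2 * U.1)

/-- Momentum flux (charge) `η(ρ,q) = q²/ρ + c²ρ`. -/
noncomputable def eta (c : ℝ) (U : ℝ × ℝ) : ℝ := U.2 ^ 2 / U.1 + c ^ 2 * U.1

/-- Numerical entropy flux of the Rusanov scheme. -/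
noncomputable def numEntFlux (c A : ℝ) (V W : ℝ × ℝ) : ℝ :=
  (entFlux c V + entFlux c W) / 2 - A / 2 * (ent c W - ent c V)

/-- The state space `Ω = {(ρ,q) : ρ > 0}`. -/
def Omega : Set (ℝ × ℝ) := {U | 0 < U.1}

/-- Subcharacteristic condition for the pair `(UL, UR)`:
the middle state has positive density and
`A ≥ max(|q_L|/ρ_L, |q_R|/ρ_R, |q_*|/ρ_*) + c`. -/
def subchar (c A : ℝ) (UL UR : ℝ × ℝ) : Prop :=
  0 < (mid c A UL UR).1 ∧
    max (|UL.2| / UL.1) (max (|UR.2| / UR.1)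
      (|(mid c A UL UR).2| / (mid c A UL UR).1)) + c ≤ A

/-- The derivative of the entropy at `b`, applied to `X`. -/
noncomputable def entDeriv (c : ℝ) (b X : ℝ × ℝ) : ℝ :=
  (c ^ 2 * (Real.log b.1 + 1) - (b.2 / b.1) ^ 2 / 2) * X.1 + b.2 / b.1 * X.2

/-- The relative entropy of `a` with respect to `b`. -/
noncomputable def relEnt (c : ℝ) (a b : ℝ × ℝ) : ℝ :=
  ent c a - ent c b - entDeriv c b (a - b)

/-- The relative entropy flux of `a` with respect to `b`. -/
noncomputable def relEntFlux (c : ℝ) (a b : ℝ × ℝ) : ℝ :=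
  entFlux c a - entFlux c b - entDeriv c b (flux c a - flux c b)

lemma relEnt_eq (c : ℝ) {a b : ℝ × ℝ} (ha : 0 < a.1) (hb : 0 < b.1) :
    relEnt c a b = a.1 * ((a.2 / a.1 - b.2 / b.1) ^ 2 / 2 +
      c ^ 2 * (Real.exp (Real.log b.1 - Real.log a.1) - 1 -
        (Real.log b.1 - Real.log a.1))) := by
  rw [Real.exp_sub, Real.exp_log ha, Real.exp_log hb]
  simp only [relEnt, ent, entDeriv, Prod.fst_sub, Prod.snd_sub]
  field_simp
  ring

lemma relEntFlux_eq (c : ℝ) {a b : ℝ × ℝ} (ha : 0 < a.1) (hb : 0 < b.1) :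
    relEntFlux c a b = a.2 / a.1 * relEnt c a b +
      c ^ 2 * (a.2 / a.1 - b.2 / b.1) * (a.1 - b.1) := by
  simp only [relEntFlux, entFlux, relEnt, flux, ent, entDeriv, Prod.fst_sub, Prod.snd_sub]
  field_simp
  ring

lemma relEnt_nonneg (c : ℝ) {a b : ℝ × ℝ} (ha : 0 < a.1) (hb : 0 < b.1) :
    0 ≤ relEnt c a b := by
  rw [relEnt_eq c ha hb]
  have h := Real.add_one_le_exp (Real.log b.1 - Real.log a.1)
  have : 0 ≤ Real.exp (Real.log b.1 - Real.log a.1) - 1 -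
      (Real.log b.1 - Real.log a.1) := by linarith
  positivity

lemma one_sub_exp_sq_le {s : ℝ} (hs : s ≤ 0) :
    (1 - Real.exp s) ^ 2 / 2 ≤ Real.exp s - 1 - s := by
  have h0 := Real.exp_pos s
  have h1 : Real.exp s ≤ 1 := Real.exp_le_one_iff.mpr hs
  have h := Real.hasSum_pow_div_log_of_abs_lt_one (x := 1 - Real.exp s)
    (by rw [abs_lt]; constructor <;> linarith)
  have h2 := sum_le_hasSum (Finset.range 2)
    (fun n _ => div_nonneg (pow_nonneg (by linarith) _) (by positivity)) h
  rw [sub_sub_cancel, Real.log_exp] at h2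
  norm_num [Finset.sum_range_succ] at h2
  linarith

lemma scaled_dissipation_nonneg {c k w s : ℝ} (hc : 0 < c) (hk : c ≤ k) (hkw : c + w ≤ k) :
    0 ≤ k * (w ^ 2 / 2 + c ^ 2 * (Real.exp s - 1 - s)) +
      c ^ 2 * w * (1 - Real.exp s) := by
  have hD : 0 ≤ w ^ 2 / 2 + c ^ 2 * (Real.exp s - 1 - s) := by
    have : 0 ≤ Real.exp s - 1 - s := by linarith [Real.add_one_le_exp s]
    positivity
  rcases le_total 0 s with hs | hs
  · have he : 1 ≤ Real.exp s := Real.one_le_exp hs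
    rcases le_total 0 w with hw | hw
    · have h1 := mul_le_mul_of_nonneg_right hkw hD
      have h2 := mul_le_mul_of_nonneg_left (Real.quadratic_le_exp_of_nonneg hs)
        (pow_pos hc 3).le
      have h3 : 0 ≤ w ^ 3 / 2 + c * (w - c * s) ^ 2 / 2 := by positivity
      linarith
    · have h1 : 0 ≤ k * (w ^ 2 / 2 + c ^ 2 * (Real.exp s - 1 - s)) :=
        mul_nonneg (hc.le.trans hk) hD
      have h2 : 0 ≤ c ^ 2 * (-w * (Real.exp s - 1)) :=
        mul_nonneg (sq_nonneg c) (mul_nonneg (by linarith) (by linarith))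
      linarith
  · have h1 := mul_le_mul_of_nonneg_right hk hD
    have h2 := mul_le_mul_of_nonneg_left (one_sub_exp_sq_le hs) (pow_pos hc 3).le
    have h3 : 0 ≤ c * (w + c * (1 - Real.exp s)) ^ 2 / 2 := by positivity
    linarith

/-- On the cone `|q| ≤ (A - c) ρ` the relative entropy flux is controlled by `A` times the
relative entropy. -/
lemma abs_relEntFlux_le {c A : ℝ} (hc : 0 < c) {a b : ℝ × ℝ} (ha : 0 < a.1) (hb : 0 < b.1)
    (hAa : |a.2| / a.1 + c ≤ A) (hAb : |b.2| / b.1 + c ≤ A) :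
    |relEntFlux c a b| ≤ A * relEnt c a b := by
  obtain ⟨ha1, ha2⟩ := abs_le.mp (show |a.2 / a.1| ≤ A - c by
    rw [abs_div, abs_of_pos ha]; linarith)
  obtain ⟨hb1, hb2⟩ := abs_le.mp (show |b.2 / b.1| ≤ A - c by
    rw [abs_div, abs_of_pos hb]; linarith)
  have hexp : a.1 * Real.exp (Real.log b.1 - Real.log a.1) = b.1 := by
    rw [Real.exp_sub, Real.exp_log ha, Real.exp_log hb]
    field_simp
  rw [relEntFlux_eq c ha hb, relEnt_eq c ha hb]
  set s := Real.log b.1 - Real.log a.1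
  set u := a.2 / a.1
  set v := b.2 / b.1
  have hp := mul_nonneg ha.le (scaled_dissipation_nonneg (k := A + u) (w := u - v) (s := s) hc
    (by linarith) (by linarith))
  have hm := mul_nonneg ha.le (scaled_dissipation_nonneg (k := A - u) (w := v - u) (s := s) hc
    (by linarith) (by linarith))
  rw [← hexp, abs_le]
  constructor <;> linarith

/-- Entropy inequality for the middle state of the Rusanov approximate Riemann solver. -/
lemma ent_mid_le {c A : ℝ} (hc : 0 < c) (hA : 0 < A) {L R : ℝ × ℝ} (hL : 0 < L.1)
    (hR : 0 < R.1) (hs : subchar c A L R) :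
    A * ent c (mid c A L R) ≤ A * (ent c L + ent c R) / 2 -
      (entFlux c R - entFlux c L) / 2 := by
  obtain ⟨hm, hmax⟩ := hs
  simp only [← max_add_add_right, max_le_iff] at hmax
  obtain ⟨hAL, hAR, hAm⟩ := hmax
  have h1 := (abs_le.mp (abs_relEntFlux_le hc hL hm hAL hAm)).1
  have h2 := (abs_le.mp (abs_relEntFlux_le hc hR hm hAR hAm)).2
  have e1 : A * (L.1 + R.1 - 2 * (mid c A L R).1) = (flux c R).1 - (flux c L).1 := by
    simp only [mid, Prod.fst_sub, Prod.fst_add, Prod.smul_fst, smul_eq_mul]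
    field_simp
    ring
  have e2 : A * (L.2 + R.2 - 2 * (mid c A L R).2) = (flux c R).2 - (flux c L).2 := by
    simp only [mid, Prod.snd_sub, Prod.snd_add, Prod.smul_snd, smul_eq_mul]
    field_simp
    ring
  simp only [relEnt, relEntFlux, entDeriv, Prod.fst_sub, Prod.snd_sub] at h1 h2
  generalize mid c A L R = m at *
  linear_combination (h1 + h2) / 2 - (c ^ 2 * (Real.log m.1 + 1) - (m.2 / m.1) ^ 2 / 2) / 2 * e1
    - m.2 / m.1 / 2 * e2

/-- The Rusanov update is a combination of the old state and the two adjacent middle states. -/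
lemma sub_smul_rus_sub (c l : ℝ) {A : ℝ} (hA : A ≠ 0) (W U V : ℝ × ℝ) :
    U - l • (rus c A U V - rus c A W U) =
      (1 - 2 * (l * A)) • U + (l * A) • mid c A U V + (l * A) • mid c A W U := by
  ext <;> simp only [rus, mid, Prod.fst_sub, Prod.fst_add, Prod.smul_fst, Prod.snd_sub,
    Prod.snd_add, Prod.smul_snd, smul_eq_mul] <;> field_simp <;> ring

/-- Convexity of the entropy for combinations of three states. -/
lemma ent_combination_le (c : ℝ) {α β γ : ℝ} (hα : 0 ≤ α) (hβ : 0 ≤ β) (hγ : 0 ≤ γ)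
    (hsum : α + β + γ = 1) {X Y Z : ℝ × ℝ} (hX : 0 < X.1) (hY : 0 < Y.1) (hZ : 0 < Z.1)
    (hP : 0 < (α • X + β • Y + γ • Z).1) :
    ent c (α • X + β • Y + γ • Z) ≤ α * ent c X + β * ent c Y + γ * ent c Z := by
  have h1 := mul_nonneg hα (relEnt_nonneg c hX hP)
  have h2 := mul_nonneg hβ (relEnt_nonneg c hY hP)
  have h3 := mul_nonneg hγ (relEnt_nonneg c hZ hP)
  have e1 : (α • X + β • Y + γ • Z).1 = α * X.1 + β * Y.1 + γ * Z.1 := rfl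
  have e2 : (α • X + β • Y + γ • Z).2 = α * X.2 + β * Y.2 + γ * Z.2 := rfl
  simp only [relEnt, entDeriv, Prod.fst_sub, Prod.snd_sub] at h1 h2 h3
  generalize α • X + β • Y + γ • Z = P at *
  obtain rfl : α = 1 - β - γ := by linarith
  linear_combination h1 + h2 + h3 + (c ^ 2 * (Real.log P.1 + 1) - (P.2 / P.1) ^ 2 / 2) * e1
    + P.2 / P.1 * e2

/-- under the subcharacteristic and CFL conditions, the Rusanov update
keeps the density positive and satisfies a discrete entropy inequality. -/
theorem stmt6 (c A : ℝ) (hc : 0 < c) (hA : 0 < A)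
    (W U V : ℝ × ℝ) (hW : W ∈ Omega) (hU : U ∈ Omega) (hV : V ∈ Omega)
    (hs1 : subchar c A W U) (hs2 : subchar c A U V)
    (dt dx : ℝ) (hdt : 0 < dt) (hdx : 0 < dx) (hcfl : A * dt / dx ≤ 1 / 2)
    (U' : ℝ × ℝ) (hU' : U' = U - (dt / dx) • (rus c A U V - rus c A W U)) :
    U' ∈ Omega ∧
    ent c U' ≤ ent c U - dt / dx * (numEntFlux c A U V - numEntFlux c A W U) := by
  have hl : 0 < dt / dx := div_pos hdt hdx
  have hlA : dt / dx * A ≤ 1 / 2 := by rwa [div_mul_eq_mul_div, mul_comm dt A]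
  generalize dt / dx = l at *
  have hpos : 0 < l * A := mul_pos hl hA
  rw [sub_smul_rus_sub c l hA.ne'] at hU'
  have hP : 0 < U'.1 := by
    have h1 : 0 ≤ (1 - 2 * (l * A)) * U.1 := mul_nonneg (by linarith) (le_of_lt hU)
    have h2 := mul_pos hpos hs1.1
    have h3 := mul_pos hpos hs2.1
    simp only [hU', Prod.fst_add, Prod.smul_fst, smul_eq_mul]
    linarith
  refine ⟨hP, ?_⟩
  rw [hU'] at hP ⊢
  have hconv := ent_combination_le c (by linarith) hpos.le hpos.le (by ring) hU hs2.1 hs1.1 hP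
  have h1 := mul_le_mul_of_nonneg_left (ent_mid_le hc hA hW hU hs1) hl.le
  have h2 := mul_le_mul_of_nonneg_left (ent_mid_le hc hA hU hV hs2) hl.le
  simp only [numEntFlux]
  linarith
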